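/- arXiv:2404.05708 — 4 statements merged into one kernel-verified Lean document; each statement's English description precedes it below -/
import Mathlib

section
/- For all indices α < P and β < Q, the dynamic-programming value M(α,β) equals the discrete Fréchet distance between the prefix sequences p restricted to indices 0,…,α and q restricted to indices 0,…,β. In particular, M(P−1,Q−1) = δ_dF(p,q). -/
/-- A legal step of a coupling: advance in `p`, in `q`, or in both. -/
def FrechetStep {P Q : ℕ} (a b : Fin P × Fin Q) : Prop :=
  ((b.1 : ℕ) = (a.1 : ℕ) + 1 ∧ (b.2 : ℕ) = (a.2 : ℕ)) ∨
  ((b.1 : ℕ) = (a.1 : ℕ) ∧ (b.2 : ℕ) = (a.2 : ℕ) + 1) ∨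
  ((b.1 : ℕ) = (a.1 : ℕ) + 1 ∧ (b.2 : ℕ) = (a.2 : ℕ) + 1)

/-- A coupling between two sequences indexed by `Fin P` and `Fin Q`. -/
def IsCoupling {P Q : ℕ} (c : List (Fin P × Fin Q)) : Prop :=
  (∃ x ∈ c.head?, (x.1 : ℕ) = 0 ∧ (x.2 : ℕ) = 0) ∧
  (∃ y ∈ c.getLast?, (y.1 : ℕ) = P - 1 ∧ (y.2 : ℕ) = Q - 1) ∧
  List.Chain' FrechetStep c

/-- The maximal pointwise distance along a coupling. -/
noncomputable def couplingCost {E : Type*} [MetricSpace E] {P Q : ℕ}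
    (p : Fin P → E) (q : Fin Q → E) (c : List (Fin P × Fin Q)) : ℝ :=
  (c.map fun ij => dist (p ij.1) (q ij.2)).foldr max 0

/-- The discrete Fréchet distance: minimum over couplings of the maximal
pointwise distance along the coupling. -/
noncomputable def discreteFrechet {E : Type*} [MetricSpace E] {P Q : ℕ}
    (p : Fin P → E) (q : Fin Q → E) : ℝ :=
  sInf { r | ∃ c, IsCoupling c ∧ couplingCost p q c = r }

/-- `M` satisfies the dynamic-programming recurrence for the discrete Fréchet distance. -/
structure IsFrechetTable {E : Type*} [MetricSpace E] {P Q : ℕ} (hP : 0 < P) (hQ : 0 < Q)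
    (p : Fin P → E) (q : Fin Q → E) (M : ℕ → ℕ → ℝ) : Prop where
  zero_zero : M 0 0 = dist (p ⟨0, hP⟩) (q ⟨0, hQ⟩)
  succ_zero : ∀ i, (hi : i + 1 < P) →
    M (i + 1) 0 = max (M i 0) (dist (p ⟨i + 1, hi⟩) (q ⟨0, hQ⟩))
  zero_succ : ∀ j, (hj : j + 1 < Q) →
    M 0 (j + 1) = max (M 0 j) (dist (p ⟨0, hP⟩) (q ⟨j + 1, hj⟩))
  succ_succ : ∀ i j, (hi : i + 1 < P) → (hj : j + 1 < Q) →
    M (i + 1) (j + 1) =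
      max (min (M i (j + 1)) (min (M i j) (M (i + 1) j)))
        (dist (p ⟨i + 1, hi⟩) (q ⟨j + 1, hj⟩))

/-- There is a chain of legal steps from `(0, 0)` to `y` of cost at most `r`. -/
def FrechetReachable {E : Type*} [MetricSpace E] {P Q : ℕ} (hP : 0 < P) (hQ : 0 < Q)
    (p : Fin P → E) (q : Fin Q → E) (r : ℝ) (y : Fin P × Fin Q) : Prop :=
  ∃ c : List (Fin P × Fin Q), c.head? = some (⟨0, hP⟩, ⟨0, hQ⟩) ∧ c.getLast? = some y ∧
    List.IsChain FrechetStep c ∧ couplingCost p q c ≤ r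

section

variable {E : Type*} [MetricSpace E] {P Q : ℕ} {hP : 0 < P} {hQ : 0 < Q}
  {p : Fin P → E} {q : Fin Q → E} {M : ℕ → ℕ → ℝ}

lemma couplingCost_singleton (x : Fin P × Fin Q) :
    couplingCost p q [x] = dist (p x.1) (q x.2) := by
  simp [couplingCost]

lemma couplingCost_concat (c : List (Fin P × Fin Q)) (y : Fin P × Fin Q) :
    couplingCost p q (c ++ [y]) = max (couplingCost p q c) (dist (p y.1) (q y.2)) := by
  induction c with
  | nil => simp [couplingCost]
  | cons x c ih =>
    simp only [couplingCost, List.cons_append, List.map_cons, List.foldr_cons] at ih ⊢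
    rw [ih, max_assoc]

lemma FrechetReachable.step {r s : ℝ} {x y : Fin P × Fin Q}
    (h : FrechetReachable hP hQ p q r x) (hxy : FrechetStep x y) (hrs : r ≤ s)
    (hy : dist (p y.1) (q y.2) ≤ s) : FrechetReachable hP hQ p q s y := by
  obtain ⟨c, hhead, hlast, hchain, hcost⟩ := h
  refine ⟨c ++ [y], by simp [hhead], by simp, ?_, ?_⟩
  · refine List.isChain_append.2 ⟨hchain, List.isChain_singleton y, ?_⟩
    simpa [hlast] using hxy
  · rw [couplingCost_concat]
    exact max_le (hcost.trans hrs) hy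

lemma IsFrechetTable.reachable (hM : IsFrechetTable hP hQ p q M) (a b : ℕ) (ha : a < P)
    (hb : b < Q) : FrechetReachable hP hQ p q (M a b) (⟨a, ha⟩, ⟨b, hb⟩) := by
  induction a generalizing b with
  | zero =>
    induction b with
    | zero =>
      exact ⟨[(⟨0, hP⟩, ⟨0, hQ⟩)], rfl, rfl, List.isChain_singleton _,
        by rw [couplingCost_singleton, hM.zero_zero]⟩
    | succ b ih =>
      rw [hM.zero_succ b hb]
      exact (ih (by omega)).step (by simp [FrechetStep]) (le_max_left _ _) (le_max_right _ _)
  | succ a iha =>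
    induction b with
    | zero =>
      rw [hM.succ_zero a ha]
      exact (iha 0 (by omega) hb).step (by simp [FrechetStep]) (le_max_left _ _)
        (le_max_right _ _)
    | succ b ihb =>
      have hrec := hM.succ_succ a b ha hb
      have hdist : dist (p ⟨a + 1, ha⟩) (q ⟨b + 1, hb⟩) ≤ M (a + 1) (b + 1) :=
        hrec ▸ le_max_right _ _
      have hmin : min (M a (b + 1)) (min (M a b) (M (a + 1) b)) ≤ M (a + 1) (b + 1) :=
        hrec ▸ le_max_left _ _
      rcases min_le_iff.1 hmin with h | h
      · exact (iha (b + 1) (by omega) hb).step (by simp [FrechetStep]) h hdist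
      rcases min_le_iff.1 h with h | h
      · exact (iha b (by omega) (by omega)).step (by simp [FrechetStep]) h hdist
      · exact (ihb (by omega)).step (by simp [FrechetStep]) h hdist

lemma IsFrechetTable.le_max_of_step (hM : IsFrechetTable hP hQ p q M) {x y : Fin P × Fin Q}
    (hxy : FrechetStep x y) : M y.1 y.2 ≤ max (M x.1 x.2) (dist (p y.1) (q y.2)) := by
  obtain ⟨⟨i, hi⟩, ⟨j, hj⟩⟩ := x
  obtain ⟨⟨k, hk⟩, ⟨l, hl⟩⟩ := y
  simp only [FrechetStep] at hxy
  rcases hxy with ⟨rfl, rfl⟩ | ⟨rfl, rfl⟩ | ⟨rfl, rfl⟩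
  · cases l with
    | zero => exact (hM.succ_zero i hk).le
    | succ l =>
      rw [hM.succ_succ i l hk hl]
      exact max_le_max_right _ (min_le_left _ _)
  · cases k with
    | zero => exact (hM.zero_succ j hl).le
    | succ k =>
      rw [hM.succ_succ k j hk hl]
      exact max_le_max_right _ ((min_le_right _ _).trans (min_le_right _ _))
  · rw [hM.succ_succ i j hk hl]
    exact max_le_max_right _ ((min_le_right _ _).trans (min_le_left _ _))

lemma IsFrechetTable.le_couplingCost (hM : IsFrechetTable hP hQ p q M)
    (c : List (Fin P × Fin Q)) (y : Fin P × Fin Q)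
    (hhead : c.head? = some (⟨0, hP⟩, ⟨0, hQ⟩)) (hlast : c.getLast? = some y)
    (hchain : List.IsChain FrechetStep c) : M y.1 y.2 ≤ couplingCost p q c := by
  induction c using List.reverseRecOn generalizing y with
  | nil => simp at hhead
  | append_singleton c z ih =>
    obtain rfl : z = y := by simpa using hlast
    rcases c.eq_nil_or_concat' with rfl | ⟨c, x, rfl⟩
    · obtain rfl : z = (⟨0, hP⟩, ⟨0, hQ⟩) := by simpa using hhead
      rw [List.nil_append, couplingCost_singleton]
      exact hM.zero_zero.le
    · obtain ⟨hc, -, hstep⟩ := List.isChain_append.1 hchain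
      rw [List.head?_append_of_ne_nil _ (by simp)] at hhead
      rw [couplingCost_concat]
      exact (hM.le_max_of_step (hstep x (by simp) z (by simp))).trans
        (max_le_max_right _ (ih x hhead (by simp) hc))

theorem IsFrechetTable.eq_discreteFrechet (hM : IsFrechetTable hP hQ p q M) :
    M (P - 1) (Q - 1) = discreteFrechet p q := by
  have hlower : ∀ c : List (Fin P × Fin Q), IsCoupling c →
      M (P - 1) (Q - 1) ≤ couplingCost p q c := by
    rintro c ⟨⟨x, hx, hx₁, hx₂⟩, ⟨y, hy, hy₁, hy₂⟩, hc⟩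
    have hx₀ : x = (⟨0, hP⟩, ⟨0, hQ⟩) := Prod.ext (Fin.ext hx₁) (Fin.ext hx₂)
    rw [← hy₁, ← hy₂]
    exact hM.le_couplingCost c y (hx₀ ▸ hx) hy hc
  obtain ⟨c, hhead, hlast, hchain, hcost⟩ :=
    hM.reachable (P - 1) (Q - 1) (by omega) (by omega)
  have hc : IsCoupling c := ⟨⟨_, hhead, rfl, rfl⟩, ⟨_, hlast, rfl, rfl⟩, hchain⟩
  have hleast : IsLeast { r | ∃ c, IsCoupling c ∧ couplingCost p q c = r }
      (M (P - 1) (Q - 1)) := by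
    refine ⟨⟨c, hc, hcost.antisymm (hlower c hc)⟩, ?_⟩
    rintro _ ⟨c', hc', rfl⟩
    exact hlower c' hc'
  exact hleast.csInf_eq.symm

end

/-- For all indices `α < P` and `β < Q`, the dynamic-programming
value `M α β` equals the discrete Fréchet distance between the prefixes of `p`
and `q` up to indices `α` and `β`; in particular `M (P-1) (Q-1)` is the discrete
Fréchet distance of `p` and `q`. -/
theorem frechet_dp_correct {E : Type*} [MetricSpace E] {P Q : ℕ}
    (hP : 1 ≤ P) (hQ : 1 ≤ Q) (p : Fin P → E) (q : Fin Q → E)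
    (M : ℕ → ℕ → ℝ)
    (hM00 : M 0 0 = dist (p ⟨0, hP⟩) (q ⟨0, hQ⟩))
    (hMi0 : ∀ i, (hi : i + 1 < P) →
      M (i + 1) 0 = max (M i 0) (dist (p ⟨i + 1, hi⟩) (q ⟨0, hQ⟩)))
    (hM0j : ∀ j, (hj : j + 1 < Q) →
      M 0 (j + 1) = max (M 0 j) (dist (p ⟨0, hP⟩) (q ⟨j + 1, hj⟩)))
    (hMij : ∀ i j, (hi : i + 1 < P) → (hj : j + 1 < Q) →
      M (i + 1) (j + 1) =
        max (min (M i (j + 1)) (min (M i j) (M (i + 1) j)))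
          (dist (p ⟨i + 1, hi⟩) (q ⟨j + 1, hj⟩))) :
    (∀ α, (hα : α < P) → ∀ β, (hβ : β < Q) →
      M α β = discreteFrechet (fun i : Fin (α + 1) => p (Fin.castLE hα i))
                              (fun j : Fin (β + 1) => q (Fin.castLE hβ j))) ∧
    M (P - 1) (Q - 1) = discreteFrechet p q := by
  have hM : IsFrechetTable hP hQ p q M := ⟨hM00, hMi0, hM0j, hMij⟩
  refine ⟨fun α hα β hβ => ?_, hM.eq_discreteFrechet⟩
  have hprefix : IsFrechetTable α.succ_pos β.succ_pos
      (fun i : Fin (α + 1) => p (Fin.castLE hα i))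
      (fun j : Fin (β + 1) => q (Fin.castLE hβ j)) M :=
    ⟨hM00, fun i hi => hMi0 i (by omega), fun j hj => hM0j j (by omega),
      fun i j hi hj => hMij i j (by omega) (by omega)⟩
  exact hprefix.eq_discreteFrechet
end

section
/- The discrete Fréchet distance satisfies the triangle inequality: for finite sequences p : Fin P → E, q : Fin Q → E, r : Fin R → E in a metric space E (with P, Q, R ≥ 1), δ_dF(p,r) ≤ δ_dF(p,q) + δ_dF(q,r). -/
/-- `FrechetReach S z a` says that legal steps lead from `a` to `z` within the region `S`. -/
inductive FrechetReach {P Q : ℕ} (S : Fin P × Fin Q → Prop) (z : Fin P × Fin Q) :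
    Fin P × Fin Q → Prop
  | refl : S z → FrechetReach S z z
  | step {a b : Fin P × Fin Q} :
      S a → FrechetStep a b → FrechetReach S z b → FrechetReach S z a

theorem FrechetReach.mem {P Q : ℕ} {S : Fin P × Fin Q → Prop} {z a : Fin P × Fin Q}
    (h : FrechetReach S z a) : S a := by
  cases h <;> assumption

theorem FrechetReach.exists_list {P Q : ℕ} {S : Fin P × Fin Q → Prop} {z a : Fin P × Fin Q}
    (h : FrechetReach S z a) :
    ∃ l : List (Fin P × Fin Q), (a :: l).getLast? = some z ∧
      List.IsChain FrechetStep (a :: l) ∧ ∀ x ∈ a :: l, S x := by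
  induction h with
  | refl hz => exact ⟨[], by simpa using hz⟩
  | @step a b ha hab _ ih =>
    obtain ⟨l, hl, hc, hS⟩ := ih
    refine ⟨b :: l, by rwa [List.getLast?_cons_cons], List.isChain_cons_cons.2 ⟨hab, hc⟩, ?_⟩
    simpa [ha] using hS

theorem FrechetReach.of_list {P Q : ℕ} {S : Fin P × Fin Q → Prop} {z : Fin P × Fin Q}
    (l : List (Fin P × Fin Q)) (a : Fin P × Fin Q) (hl : (a :: l).getLast? = some z)
    (hc : List.IsChain FrechetStep (a :: l)) (hS : ∀ x ∈ a :: l, S x) :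
    FrechetReach S z a := by
  induction l generalizing a with
  | nil =>
    obtain rfl : a = z := by simpa using hl
    exact .refl (hS a (by simp))
  | cons b l ih =>
    rw [List.isChain_cons_cons] at hc
    rw [List.getLast?_cons_cons] at hl
    exact .step (hS a (by simp)) hc.1
      (ih b hl hc.2 fun x hx => hS x (List.mem_cons_of_mem _ hx))

/-- Every index pair is joined to the last one when no region is imposed. -/
theorem FrechetReach.to_last {P Q : ℕ} (z : Fin P × Fin Q) (a : Fin P × Fin Q)
    (h₁ : (a.1 : ℕ) ≤ z.1) (h₂ : (a.2 : ℕ) ≤ z.2) :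
    FrechetReach (fun _ => True) z a := by
  induction hn : ((z.1 : ℕ) - a.1) + ((z.2 : ℕ) - a.2) generalizing a with
  | zero =>
    obtain rfl : a = z := by
      ext <;> omega
    exact .refl trivial
  | succ n ih =>
    by_cases h : (a.1 : ℕ) < z.1
    · exact .step (b := (⟨a.1 + 1, by omega⟩, a.2)) trivial (.inl ⟨rfl, rfl⟩)
        (ih _ h h₂ (by simp only; omega))
    · have h' : (a.2 : ℕ) < z.2 := by omega
      exact .step (b := (a.1, ⟨a.2 + 1, by omega⟩)) trivial (.inr (.inl ⟨rfl, rfl⟩))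
        (ih _ h₁ h' (by simp only; omega))

/-- Paths in the first two and in the last two index sets compose, provided they start from and
end at the same middle index, the final one being the greatest. -/
theorem FrechetReach.comp {P Q R : ℕ} {S : Fin P × Fin Q → Prop} {T : Fin Q × Fin R → Prop}
    {x : Fin P} {y : Fin Q} {w : Fin R} (hy : (y : ℕ) = Q - 1) {a : Fin P × Fin Q}
    (ha : FrechetReach S (x, y) a) :
    ∀ b : Fin Q × Fin R, b.1 = a.2 → FrechetReach T (y, w) b →
      FrechetReach (fun ik => ∃ j, S (ik.1, j) ∧ T (j, ik.2)) (x, w) (a.1, b.2) := by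
  induction ha with
  | refl hz =>
    intro b hb hbr
    induction hbr with
    | refl hw => exact .refl ⟨y, hz, hw⟩
    | @step b c hbT hbc hcr ih =>
      have hb' : (b.1 : ℕ) = y := congrArg Fin.val hb
      have hc : c.1 = y := by
        have := c.1.isLt
        unfold FrechetStep at hbc
        ext
        omega
      refine .step ⟨y, hz, (show b.1 = y from hb) ▸ hbT⟩ ?_ (ih hc)
      unfold FrechetStep at hbc ⊢
      simp only [hc, true_and] at hbc ⊢
      omega
  | @step a a' haS haa' _ iha =>
    intro b hb hbr
    by_cases hj : a'.2 = a.2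
    · refine .step ⟨a.2, haS, ?_⟩ ?_ (iha b (hb.trans hj.symm) hbr)
      · simpa [← hb] using hbr.mem
      · unfold FrechetStep at haa' ⊢
        simp only [hj, and_true] at haa' ⊢
        omega
    · have hj' : (a'.2 : ℕ) = a.2 + 1 := by
        rw [Fin.ext_iff] at hj
        unfold FrechetStep at haa'
        omega
      induction hbr with
      | refl hw =>
        have := a'.2.isLt
        have : (y : ℕ) = a.2 := congrArg Fin.val hb
        omega
      | @step b c hbT hbc hcr ih =>
        have hb' : (b.1 : ℕ) = a.2 := congrArg Fin.val hb
        have hG : ∃ j, S (a.1, j) ∧ T (j, b.2) := ⟨a.2, haS, by simpa [← hb] using hbT⟩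
        by_cases hc : c.1 = a.2
        · refine .step hG ?_ (ih hc)
          have hc' : (c.1 : ℕ) = a.2 := congrArg Fin.val hc
          unfold FrechetStep at hbc ⊢
          simp only [true_and] at hbc ⊢
          omega
        · have hc' : c.1 = a'.2 := by
            rw [Fin.ext_iff] at hc ⊢
            unfold FrechetStep at hbc
            omega
          have hcv : (c.1 : ℕ) = a'.2 := congrArg Fin.val hc'
          have hr := iha c hc' hcr
          by_cases he : (a'.1, c.2) = (a.1, b.2)
          · rwa [he] at hr
          · refine .step hG ?_ hr
            simp only [Prod.mk.injEq, Fin.ext_iff] at he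
            unfold FrechetStep at haa' hbc ⊢
            simp only at haa' hbc ⊢
            omega

theorem couplingCost_le_iff {E : Type*} [MetricSpace E] {P Q : ℕ}
    (p : Fin P → E) (q : Fin Q → E) (c : List (Fin P × Fin Q)) (t : ℝ) :
    couplingCost p q c ≤ t ↔ 0 ≤ t ∧ ∀ x ∈ c, dist (p x.1) (q x.2) ≤ t := by
  unfold couplingCost
  induction c with
  | nil => simp
  | cons a c ih =>
    simp only [List.map_cons, List.foldr_cons, max_le_iff, ih, List.forall_mem_cons]
    tauto

theorem IsCoupling.frechetReach {P Q : ℕ} {c : List (Fin P × Fin Q)} (hc : IsCoupling c)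
    {S : Fin P × Fin Q → Prop} (hS : ∀ x ∈ c, S x) {a z : Fin P × Fin Q}
    (ha₁ : (a.1 : ℕ) = 0) (ha₂ : (a.2 : ℕ) = 0)
    (hz₁ : (z.1 : ℕ) = P - 1) (hz₂ : (z.2 : ℕ) = Q - 1) : FrechetReach S z a := by
  obtain ⟨⟨x, hx, hx₁, hx₂⟩, ⟨y, hy, hy₁, hy₂⟩, hch⟩ := hc
  obtain rfl : x = a := by ext <;> omega
  obtain rfl : y = z := by ext <;> omega
  cases c with
  | nil => simp at hx
  | cons b l =>
    obtain rfl : b = x := by simpa using hx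
    exact .of_list l b hy hch hS

theorem FrechetReach.exists_isCoupling {P Q : ℕ} {S : Fin P × Fin Q → Prop}
    {a z : Fin P × Fin Q} (h : FrechetReach S z a)
    (ha₁ : (a.1 : ℕ) = 0) (ha₂ : (a.2 : ℕ) = 0)
    (hz₁ : (z.1 : ℕ) = P - 1) (hz₂ : (z.2 : ℕ) = Q - 1) :
    ∃ c, IsCoupling c ∧ ∀ x ∈ c, S x := by
  obtain ⟨l, hl, hc, hS⟩ := h.exists_list
  exact ⟨a :: l, ⟨⟨a, rfl, ha₁, ha₂⟩, ⟨z, hl, hz₁, hz₂⟩, hc⟩, hS⟩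

theorem exists_isCoupling {P Q : ℕ} (hP : 1 ≤ P) (hQ : 1 ≤ Q) :
    ∃ c : List (Fin P × Fin Q), IsCoupling c := by
  obtain ⟨c, hc, -⟩ := (FrechetReach.to_last
    ((⟨P - 1, by omega⟩, ⟨Q - 1, by omega⟩) : Fin P × Fin Q)
    (⟨0, hP⟩, ⟨0, hQ⟩) (Nat.zero_le _) (Nat.zero_le _)).exists_isCoupling rfl rfl rfl rfl
  exact ⟨c, hc⟩

theorem discreteFrechet_le_couplingCost {E : Type*} [MetricSpace E] {P Q : ℕ}
    (p : Fin P → E) (q : Fin Q → E) {c : List (Fin P × Fin Q)} (hc : IsCoupling c) :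
    discreteFrechet p q ≤ couplingCost p q c := by
  refine csInf_le ⟨0, ?_⟩ ⟨c, hc, rfl⟩
  rintro _ ⟨c, -, rfl⟩
  exact ((couplingCost_le_iff p q c _).1 le_rfl).1

/-- Couplings compose through the middle sequence, and their costs add up. -/
theorem IsCoupling.exists_comp {E : Type*} [MetricSpace E] {P Q R : ℕ}
    (hP : 1 ≤ P) (hQ : 1 ≤ Q) (hR : 1 ≤ R)
    (p : Fin P → E) (q : Fin Q → E) (r : Fin R → E)
    {c : List (Fin P × Fin Q)} {d : List (Fin Q × Fin R)}
    (hc : IsCoupling c) (hd : IsCoupling d) :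
    ∃ e : List (Fin P × Fin R), IsCoupling e ∧
      couplingCost p r e ≤ couplingCost p q c + couplingCost q r d := by
  obtain ⟨hc₀, hcS⟩ := (couplingCost_le_iff p q c _).1 le_rfl
  obtain ⟨hd₀, hdS⟩ := (couplingCost_le_iff q r d _).1 le_rfl
  have h₁ := hc.frechetReach hcS (a := (⟨0, hP⟩, ⟨0, hQ⟩))
    (z := (⟨P - 1, by omega⟩, ⟨Q - 1, by omega⟩)) rfl rfl rfl rfl
  have h₂ := hd.frechetReach hdS (a := (⟨0, hQ⟩, ⟨0, hR⟩))
    (z := (⟨Q - 1, by omega⟩, ⟨R - 1, by omega⟩)) rfl rfl rfl rfl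
  obtain ⟨e, he, heS⟩ := (h₁.comp rfl _ rfl h₂).exists_isCoupling rfl rfl rfl rfl
  refine ⟨e, he, (couplingCost_le_iff p r e _).2 ⟨add_nonneg hc₀ hd₀, fun x hx => ?_⟩⟩
  obtain ⟨j, hj₁, hj₂⟩ := heS x hx
  exact (dist_triangle _ (q j) _).trans (add_le_add hj₁ hj₂)

/-- The discrete Fréchet distance satisfies the triangle
inequality. -/
theorem discreteFrechet_triangle {E : Type*} [MetricSpace E] {P Q R : ℕ}
    (hP : 1 ≤ P) (hQ : 1 ≤ Q) (hR : 1 ≤ R)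
    (p : Fin P → E) (q : Fin Q → E) (r : Fin R → E) :
    discreteFrechet p r ≤ discreteFrechet p q + discreteFrechet q r := by
  obtain ⟨c₀, hc₀⟩ := exists_isCoupling hP hQ
  obtain ⟨d₀, hd₀⟩ := exists_isCoupling hQ hR
  rw [← sub_le_iff_le_add]
  refine le_csInf ⟨_, c₀, hc₀, rfl⟩ ?_
  rintro _ ⟨c, hc, rfl⟩
  rw [sub_le_comm]
  refine le_csInf ⟨_, d₀, hd₀, rfl⟩ ?_
  rintro _ ⟨d, hd, rfl⟩
  obtain ⟨e, he, hle⟩ := hc.exists_comp hP hQ hR p q r hd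
  rw [sub_le_iff_le_add']
  exact (discreteFrechet_le_couplingCost p r he).trans hle
end

section
/- Any optimal coupling may be taken to have length at most P + Q − 1: for finite sequences p : Fin P → E and q : Fin Q → E in a metric space E, there exists a coupling of length L ≤ P + Q − 1 whose maximum pointwise distance equals δ_dF(p,q). -/
/-- Along a chain of coupling steps the sum of the indices increases by at least one per step. -/
theorem length_le_of_isChain_frechetStep {P Q : ℕ} {x y : Fin P × Fin Q} {l : List (Fin P × Fin Q)}
    (hl : (x :: l).IsChain FrechetStep) (hy : y ∈ (x :: l).getLast?) :
    x.1.val + x.2.val + l.length ≤ y.1.val + y.2.val := by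
  induction l generalizing x with
  | nil => simp_all
  | cons z l ih =>
    rw [List.isChain_cons_cons] at hl
    have hz := ih hl.2 (by simpa using hy)
    have hstep := hl.1
    simp only [FrechetStep] at hstep
    simp only [List.length_cons]
    omega

theorem IsCoupling.length_le {P Q : ℕ} {c : List (Fin P × Fin Q)} (hc : IsCoupling c) :
    c.length ≤ P + Q - 1 := by
  obtain ⟨-, ⟨y, hy, -⟩, hc⟩ := hc
  cases c with
  | nil => simp
  | cons x l =>
    have := length_le_of_isChain_frechetStep hc hy
    simp only [List.length_cons]
    omega

theorem FrechetStep.reflTransGen_zero {P Q : ℕ} (i j : ℕ) (hi : i < P) (hj : j < Q) :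
    Relation.ReflTransGen FrechetStep
      ((⟨0, by omega⟩, ⟨0, by omega⟩) : Fin P × Fin Q) (⟨i, hi⟩, ⟨j, hj⟩) := by
  induction i with
  | zero =>
    induction j with
    | zero => exact .refl
    | succ j ih => exact (ih (by omega)).tail (by simp [FrechetStep])
  | succ i ih => exact (ih (by omega)).tail (by simp [FrechetStep])

theorem finite_setOf_isCoupling (P Q : ℕ) :
    {c : List (Fin P × Fin Q) | IsCoupling c}.Finite :=
  (List.finite_length_le _ (P + Q - 1)).subset fun _ hc => hc.length_le

/-- There is an optimal coupling of length at most `P + Q - 1`: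
its maximal pointwise distance equals the discrete Fréchet distance. -/
theorem exists_short_optimal_coupling {E : Type*} [MetricSpace E] {P Q : ℕ}
    (hP : 1 ≤ P) (hQ : 1 ≤ Q) (p : Fin P → E) (q : Fin Q → E) :
    ∃ c : List (Fin P × Fin Q), IsCoupling c ∧ c.length ≤ P + Q - 1 ∧
      couplingCost p q c = discreteFrechet p q := by
  obtain ⟨c₀, hc₀⟩ := exists_isCoupling hP hQ
  obtain ⟨c, hc, hcost⟩ := Set.Nonempty.csInf_mem
    (s := {r | ∃ c, IsCoupling c ∧ couplingCost p q c = r}) ⟨_, c₀, hc₀, rfl⟩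
    ((finite_setOf_isCoupling P Q).image (couplingCost p q))
  exact ⟨c, hc, hc.length_le, hcost⟩
end

section
/- Replacing the maximum by summation in the Fréchet dynamic program computes the dynamic time warping (DTW) distance: for all i < P and j < Q, S(i,j) equals the minimum over couplings between the prefixes p|_{0..i} and q|_{0..j} of the sum Σ_k dist(p_{i_k}, q_{j_k}); in particular S(P−1,Q−1) = DTW(p,q). -/
/-- The sum of pointwise distances along a coupling. -/
noncomputable def couplingSum {E : Type*} [MetricSpace E] {P Q : ℕ}
    (p : Fin P → E) (q : Fin Q → E) (c : List (Fin P × Fin Q)) : ℝ :=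
  (c.map fun ij => dist (p ij.1) (q ij.2)).sum

/-- The dynamic time warping (DTW) distance: minimum over couplings of the sum
of pointwise distances along the coupling. -/
noncomputable def dtwDist {E : Type*} [MetricSpace E] {P Q : ℕ}
    (p : Fin P → E) (q : Fin Q → E) : ℝ :=
  sInf { r | ∃ c, IsCoupling c ∧ couplingSum p q c = r }

/-- A dynamic program whose values never exceed the cost of any extension bounds from below the
sum along every coupling of prefixes. -/
theorem le_couplingSum_of_step_le {E : Type*} [MetricSpace E] {P Q : ℕ}
    (p : Fin P → E) (q : Fin Q → E) (S : ℕ → ℕ → ℝ)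
    (h0 : ∀ x : Fin P × Fin Q, (x.1 : ℕ) = 0 → (x.2 : ℕ) = 0 →
      S x.1 x.2 ≤ dist (p x.1) (q x.2))
    (hstep : ∀ x y : Fin P × Fin Q, FrechetStep x y →
      S y.1 y.2 ≤ S x.1 x.2 + dist (p y.1) (q y.2))
    (c : List (Fin P × Fin Q)) (hc : c.IsChain FrechetStep)
    (hhead : ∃ x ∈ c.head?, (x.1 : ℕ) = 0 ∧ (x.2 : ℕ) = 0)
    (y : Fin P × Fin Q) (hy : y ∈ c.getLast?) :
    S y.1 y.2 ≤ couplingSum p q c := by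
  induction c using List.reverseRecOn generalizing y with
  | nil => simp at hy
  | append_singleton c z ih =>
    obtain rfl : z = y := by simpa using hy
    rcases List.eq_nil_or_concat' c with rfl | ⟨l, w, rfl⟩
    · obtain ⟨x, hx, hx1, hx2⟩ := hhead
      obtain rfl : z = x := by simpa using hx
      simpa [couplingSum] using h0 z hx1 hx2
    · rw [List.isChain_append] at hc
      have hw := ih hc.1 (by simpa using hhead) w (by simp)
      have hs := hstep w z (hc.2.2 w (by simp) z (by simp))
      have hsum : couplingSum p q (l ++ [w] ++ [z]) =
          couplingSum p q (l ++ [w]) + dist (p z.1) (q z.2) := by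
        simp [couplingSum, add_assoc]
      linarith

/-- If every value of a dynamic program is attained by extending a predecessor, it is the sum along
some coupling of prefixes. -/
theorem exists_couplingSum_eq {E : Type*} [MetricSpace E] {P Q : ℕ}
    (p : Fin P → E) (q : Fin Q → E) (S : ℕ → ℕ → ℝ)
    (h : ∀ y : Fin P × Fin Q,
      ((y.1 : ℕ) = 0 ∧ (y.2 : ℕ) = 0 ∧ S y.1 y.2 = dist (p y.1) (q y.2)) ∨
      ∃ x, FrechetStep x y ∧ S y.1 y.2 = S x.1 x.2 + dist (p y.1) (q y.2))
    (y : Fin P × Fin Q) :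
    ∃ c : List (Fin P × Fin Q), c.IsChain FrechetStep ∧
      (∃ x ∈ c.head?, (x.1 : ℕ) = 0 ∧ (x.2 : ℕ) = 0) ∧ y ∈ c.getLast? ∧
      couplingSum p q c = S y.1 y.2 := by
  induction hn : (y.1 : ℕ) + y.2 using Nat.strong_induction_on generalizing y with
  | _ n ih =>
    rcases h y with ⟨h1, h2, hS⟩ | ⟨x, hxy, hS⟩
    · exact ⟨[y], by simp, ⟨y, by simp, h1, h2⟩, by simp, by simp [couplingSum, hS]⟩
    · obtain ⟨c, hc, ⟨z, hz, hz0⟩, hlast, hsum⟩ :=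
        ih _ (by unfold FrechetStep at hxy; omega) x rfl
      refine ⟨c ++ [y], ?_, ⟨z, ?_, hz0⟩, by simp, ?_⟩
      · rw [List.isChain_append]
        refine ⟨hc, by simp, fun u hu v hv => ?_⟩
        obtain rfl : x = u := Option.mem_unique hlast hu
        obtain rfl : y = v := by simpa using hv
        exact hxy
      · simp_all
      · rw [hS, ← hsum]
        simp [couplingSum]

/-- The last entry of the DTW dynamic program is the DTW distance. -/
theorem dtw_dp_last_eq_dtwDist {E : Type*} [MetricSpace E] {P Q : ℕ}
    (hP : 1 ≤ P) (hQ : 1 ≤ Q) (p : Fin P → E) (q : Fin Q → E)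
    (S : ℕ → ℕ → ℝ)
    (hS00 : S 0 0 = dist (p ⟨0, hP⟩) (q ⟨0, hQ⟩))
    (hSi0 : ∀ i, (hi : i + 1 < P) →
      S (i + 1) 0 = S i 0 + dist (p ⟨i + 1, hi⟩) (q ⟨0, hQ⟩))
    (hS0j : ∀ j, (hj : j + 1 < Q) →
      S 0 (j + 1) = S 0 j + dist (p ⟨0, hP⟩) (q ⟨j + 1, hj⟩))
    (hSij : ∀ i j, (hi : i + 1 < P) → (hj : j + 1 < Q) →
      S (i + 1) (j + 1) =
        min (S i (j + 1)) (min (S i j) (S (i + 1) j)) +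
          dist (p ⟨i + 1, hi⟩) (q ⟨j + 1, hj⟩)) :
    S (P - 1) (Q - 1) = dtwDist p q := by
  have h0 : ∀ x : Fin P × Fin Q, (x.1 : ℕ) = 0 → (x.2 : ℕ) = 0 →
      S x.1 x.2 ≤ dist (p x.1) (q x.2) := by
    rintro ⟨⟨a, ha⟩, ⟨b, hb⟩⟩ h1 h2
    obtain rfl : a = 0 := h1
    obtain rfl : b = 0 := h2
    exact hS00.le
  have hstep : ∀ x y : Fin P × Fin Q, FrechetStep x y →
      S y.1 y.2 ≤ S x.1 x.2 + dist (p y.1) (q y.2) := by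
    rintro ⟨⟨a, ha⟩, ⟨b, hb⟩⟩ ⟨⟨a', ha'⟩, ⟨b', hb'⟩⟩ h
    simp only [FrechetStep] at h
    rcases h with ⟨rfl, rfl⟩ | ⟨rfl, rfl⟩ | ⟨rfl, rfl⟩
    · cases b' with
      | zero => exact (hSi0 a ha').le
      | succ b => simp [hSij a b ha' hb']
    · cases a' with
      | zero => exact (hS0j b hb').le
      | succ a => simp [hSij a b ha' hb']
    · simp [hSij a b ha' hb']
  have hattained : ∀ y : Fin P × Fin Q,
      ((y.1 : ℕ) = 0 ∧ (y.2 : ℕ) = 0 ∧ S y.1 y.2 = dist (p y.1) (q y.2)) ∨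
      ∃ x, FrechetStep x y ∧ S y.1 y.2 = S x.1 x.2 + dist (p y.1) (q y.2) := by
    rintro ⟨⟨_ | a, ha⟩, ⟨_ | b, hb⟩⟩
    · exact Or.inl ⟨rfl, rfl, hS00⟩
    · exact Or.inr ⟨(⟨0, ha⟩, ⟨b, by omega⟩), by simp [FrechetStep], hS0j b hb⟩
    · exact Or.inr ⟨(⟨a, by omega⟩, ⟨0, hb⟩), by simp [FrechetStep], hSi0 a ha⟩
    · have hS := hSij a b ha hb
      right
      rcases min_choice (S a (b + 1)) (min (S a b) (S (a + 1) b)) with h | h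
      · rw [h] at hS
        exact ⟨(⟨a, by omega⟩, ⟨b + 1, hb⟩), by simp [FrechetStep], hS⟩
      · rw [h] at hS
        rcases min_choice (S a b) (S (a + 1) b) with h | h <;> rw [h] at hS
        · exact ⟨(⟨a, by omega⟩, ⟨b, by omega⟩), by simp [FrechetStep], hS⟩
        · exact ⟨(⟨a + 1, ha⟩, ⟨b, by omega⟩), by simp [FrechetStep], hS⟩
  have hleast : IsLeast {r | ∃ c, IsCoupling c ∧ couplingSum p q c = r} (S (P - 1) (Q - 1)) := by
    constructor
    · obtain ⟨c, hc, hhead, hlast, hsum⟩ := exists_couplingSum_eq p q S hattained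
        (⟨P - 1, by omega⟩, ⟨Q - 1, by omega⟩)
      exact ⟨c, ⟨hhead, ⟨_, hlast, rfl, rfl⟩, hc⟩, hsum⟩
    · rintro _ ⟨c, ⟨hhead, ⟨y, hy, hy1, hy2⟩, hc⟩, rfl⟩
      rw [← hy1, ← hy2]
      exact le_couplingSum_of_step_le p q S h0 hstep c hc hhead y hy
  exact hleast.csInf_eq.symm

/-- Replacing the maximum by summation in the Fréchet dynamic
program computes the DTW distance: `S i j` is the DTW distance of the prefixes
up to `i` and `j`; in particular `S (P-1) (Q-1) = DTW(p,q)`. -/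
theorem dtw_dp_correct {E : Type*} [MetricSpace E] {P Q : ℕ}
    (hP : 1 ≤ P) (hQ : 1 ≤ Q) (p : Fin P → E) (q : Fin Q → E)
    (S : ℕ → ℕ → ℝ)
    (hS00 : S 0 0 = dist (p ⟨0, hP⟩) (q ⟨0, hQ⟩))
    (hSi0 : ∀ i, (hi : i + 1 < P) →
      S (i + 1) 0 = S i 0 + dist (p ⟨i + 1, hi⟩) (q ⟨0, hQ⟩))
    (hS0j : ∀ j, (hj : j + 1 < Q) →
      S 0 (j + 1) = S 0 j + dist (p ⟨0, hP⟩) (q ⟨j + 1, hj⟩))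
    (hSij : ∀ i j, (hi : i + 1 < P) → (hj : j + 1 < Q) →
      S (i + 1) (j + 1) =
        min (S i (j + 1)) (min (S i j) (S (i + 1) j)) +
          dist (p ⟨i + 1, hi⟩) (q ⟨j + 1, hj⟩)) :
    (∀ i, (hi : i < P) → ∀ j, (hj : j < Q) →
      S i j = dtwDist (fun a : Fin (i + 1) => p (Fin.castLE hi a))
                      (fun b : Fin (j + 1) => q (Fin.castLE hj b))) ∧
    S (P - 1) (Q - 1) = dtwDist p q := by
  refine ⟨fun i hi j hj => ?_, dtw_dp_last_eq_dtwDist hP hQ p q S hS00 hSi0 hS0j hSij⟩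
  exact dtw_dp_last_eq_dtwDist (Nat.succ_pos i) (Nat.succ_pos j) _ _ S hS00
    (fun a ha => hSi0 a (by omega)) (fun b hb => hS0j b (by omega))
    (fun a b ha hb => hSij a b (by omega) (by omega))
end
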